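/- Let p ≥ 5 be a prime and G a finite p-group with |G : G^p γ₂(G)| = |{g ∈ G : g^p = 1}|, i.e., the order of the Frattini quotient equals the number of solutions of x^p = 1 in G. Then [G,G] ≤ G^p, i.e., G is powerful. -/

import Mathlib

/-- The subgroup generated by `n`-th powers of elements of `H`. -/
def powSubgroup {G : Type*} [Group G] (H : Subgroup G) (n : ℕ) : Subgroup G :=
  Subgroup.closure {x | ∃ h ∈ H, h ^ n = x}

open scoped commutatorElement

section Elementwise

variable {G : Type*} [Group G]

/-- Collection formula for `(y * x) ^ m` when `v = ⁅x, u⁆` and `w = ⁅u, y⁆` are central in the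
subgroup generated by `x` and `y`, where `u = ⁅x, y⁆`. -/
theorem mul_pow_eq_of_commute {x y u v w : G} (hu : x * y = u * y * x) (hv : x * u = v * u * x)
    (hw : u * y = w * y * u) (hvx : Commute v x) (hvu : Commute v u) (hwx : Commute w x)
    (hwy : Commute w y) (hwu : Commute w u) (m : ℕ) :
    (y * x) ^ m = y ^ m * u ^ m.choose 2 * v ^ m.choose 3 * w ^ (m + 1).choose 3 * x ^ m := by
  have huy (n : ℕ) : u * y ^ n = w ^ n * y ^ n * u := by
    rw [← hwy.mul_pow]
    exact SemiconjBy.pow_right (show SemiconjBy u y (w * y) from hw) n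
  have huyn (n : ℕ) : (u * y) ^ n = y ^ n * u ^ n * w ^ (n + 1).choose 2 := by
    induction n with
    | zero => simp
    | succ n ih =>
      have e : (n + 2).choose 2 = n + 1 + (n + 1).choose 2 := by
        simp [Nat.choose_succ_succ' (n + 1) 1]
      calc (u * y) ^ (n + 1) = u * y ^ (n + 1) * u ^ n * w ^ (n + 1).choose 2 := by
            rw [pow_succ', ih, pow_succ' y]; simp only [mul_assoc]
        _ = w ^ (n + 1) * (y ^ (n + 1) * u ^ (n + 1)) * w ^ (n + 1).choose 2 := by
            rw [huy, pow_succ' u]; simp only [mul_assoc]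
        _ = _ := by
            rw [(((hwy.pow_right _).mul_right (hwu.pow_right _)).pow_left (n + 1)).eq, e,
              pow_add w (n + 1)]
            simp only [mul_assoc]
  have hym (n : ℕ) : x * y ^ n = y ^ n * u ^ n * w ^ (n + 1).choose 2 * x := by
    rw [← huyn]
    exact SemiconjBy.pow_right (show SemiconjBy x y (u * y) from hu) n
  have hum (n : ℕ) : x * u ^ n = v ^ n * u ^ n * x := by
    rw [← hvu.mul_pow]
    exact SemiconjBy.pow_right (show SemiconjBy x u (v * u) from hv) n
  induction m with
  | zero => simp [Nat.choose_eq_zero_of_lt]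
  | succ m ih =>
    set a := m.choose 2
    set b := m.choose 3
    set c := (m + 1).choose 3
    set d := (m + 1).choose 2
    have e2 : (m + 1).choose 2 = m + a := by simp [Nat.choose_succ_succ' m 1, a]
    have e3 : (m + 1).choose 3 = a + b := Nat.choose_succ_succ' m 2
    have e4 : (m + 2).choose 3 = d + c := Nat.choose_succ_succ' (m + 1) 2
    have hvu' : v ^ a * u ^ a = u ^ a * v ^ a := (hvu.pow_pow a a).eq
    have hxv : x * v ^ b = v ^ b * x := (hvx.pow_left b).eq.symm
    have hxw : x * w ^ c = w ^ c * x := (hwx.pow_left c).eq.symm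
    have hwu' : w ^ d * u ^ a = u ^ a * w ^ d := (hwu.pow_pow d a).eq
    have hwv : w ^ d * v ^ (a + b) = v ^ (a + b) * w ^ d := by
      have hwv : Commute w v := by
        have : v = x * u * x⁻¹ * u⁻¹ := by rw [hv]; group
        rw [this]
        exact ((hwx.mul_right hwu).mul_right hwx.inv_right).mul_right hwu.inv_right
      exact (hwv.pow_pow d (a + b)).eq
    calc (y * x) ^ (m + 1) = y * (x * y ^ m) * u ^ a * v ^ b * w ^ c * x ^ m := by
          rw [pow_succ', ih]; simp only [mul_assoc]
      _ = y * (y ^ m * u ^ m * w ^ d) * (x * u ^ a) * v ^ b * w ^ c * x ^ m := by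
          rw [hym]; simp only [mul_assoc, d]
      _ = y * (y ^ m * u ^ m * w ^ d) * (u ^ a * v ^ a) * (x * v ^ b) * w ^ c * x ^ m := by
          rw [hum, hvu']; simp only [mul_assoc]
      _ = y * y ^ m * u ^ m * (w ^ d * u ^ a) * v ^ (a + b) * (x * w ^ c) * x ^ m := by
          rw [hxv, pow_add]; simp only [mul_assoc]
      _ = y * y ^ m * u ^ m * u ^ a * (w ^ d * v ^ (a + b)) * w ^ c * (x * x ^ m) := by
          rw [hwu', hxw]; simp only [mul_assoc]
      _ = y ^ (m + 1) * u ^ (m + a) * v ^ (a + b) * w ^ (d + c) * x ^ (m + 1) := by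
          rw [hwv, pow_succ' y, pow_add u, pow_add w, pow_succ' x]; simp only [mul_assoc]
      _ = _ := by rw [← e2, ← e3, ← e4]

theorem commutatorElement_pow_left_of_commute {a b : G} (h : Commute ⁅a, b⁆ a) (n : ℕ) :
    ⁅a ^ n, b⁆ = ⁅a, b⁆ ^ n := by
  have h1 : b * a * b⁻¹ = ⁅a, b⁆⁻¹ * a := by simp [commutatorElement_def, mul_assoc]
  have h2 : b * a ^ n * b⁻¹ = ⁅a, b⁆⁻¹ ^ n * a ^ n := by
    rw [← conj_pow, h1, h.inv_left.mul_pow]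
  calc ⁅a ^ n, b⁆ = a ^ n * (b * a ^ n * b⁻¹)⁻¹ := by simp [commutatorElement_def, mul_assoc]
    _ = ⁅a, b⁆ ^ n := by rw [h2, mul_inv_rev, mul_inv_cancel_left, inv_pow, inv_inv]

theorem commutatorElement_pow_right_of_commute {a b : G} (h : Commute ⁅a, b⁆ b) (n : ℕ) :
    ⁅a, b ^ n⁆ = ⁅a, b⁆ ^ n := by
  have h' : Commute ⁅b, a⁆ b := by rw [← commutatorElement_inv]; exact h.inv_left
  rw [← commutatorElement_inv, commutatorElement_pow_left_of_commute h', ← inv_pow,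
    commutatorElement_inv]

variable {p : ℕ}

theorem pow_choose_two_eq_one (hp : p.Prime) (hp2 : 2 < p) {z : G} (hz : z ^ p = 1) :
    z ^ p.choose 2 = 1 :=
  orderOf_dvd_iff_pow_eq_one.1
    ((orderOf_dvd_of_pow_eq_one hz).trans (hp.dvd_choose_self two_ne_zero hp2))

theorem pow_choose_three_eq_one (hp : p.Prime) (hp3 : 3 < p) {z : G} (hz : z ^ p = 1) :
    z ^ p.choose 3 = 1 :=
  orderOf_dvd_iff_pow_eq_one.1
    ((orderOf_dvd_of_pow_eq_one hz).trans (hp.dvd_choose_self three_ne_zero hp3))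

/-- For odd `p` the `p`-th power is multiplicative on a pair of elements whose commutator
has order dividing `p` and commutes with both of them. -/
theorem mul_pow_prime_of_commute (hp : p.Prime) (hp2 : 2 < p) {a b : G} (ha : Commute ⁅b, a⁆ a)
    (hb : Commute ⁅b, a⁆ b) (hz : ⁅b, a⁆ ^ p = 1) : (a * b) ^ p = a ^ p * b ^ p := by
  have := mul_pow_eq_of_commute (x := b) (y := a) (u := ⁅b, a⁆) (v := 1) (w := 1)
    (by simp [commutatorElement_def]) (by simpa using hb.symm.eq) (by simpa using ha.eq)
    (.one_left _) (.one_left _) (.one_left _) (.one_left _) (.one_left _) p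
  simpa [pow_choose_two_eq_one hp hp2 hz] using this

/-- For `p ≥ 5` the `p`-th power is multiplicative on a pair of elements generating a subgroup of
class at most three, provided that the relevant commutators have order dividing `p`. -/
theorem mul_pow_prime_of_commute_of_commute (hp : p.Prime) (hp3 : 3 < p) {a b : G}
    (hba : Commute ⁅b, ⁅b, a⁆⁆ a) (hbb : Commute ⁅b, ⁅b, a⁆⁆ b)
    (haa : Commute ⁅⁅b, a⁆, a⁆ a) (hab : Commute ⁅⁅b, a⁆, a⁆ b)
    (hu : ⁅b, a⁆ ^ p = 1) (hv : ⁅b, ⁅b, a⁆⁆ ^ p = 1) (hw : ⁅⁅b, a⁆, a⁆ ^ p = 1) :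
    (a * b) ^ p = a ^ p * b ^ p := by
  have aux {z : G} (h₁ : Commute z a) (h₂ : Commute z b) : Commute z ⁅b, a⁆ :=
    ((h₂.mul_right h₁).mul_right h₂.inv_right).mul_right h₁.inv_right
  have hmul (g h : G) : g * h = ⁅g, h⁆ * h * g := by simp [commutatorElement_def]
  have hw' : ⁅⁅b, a⁆, a⁆ ^ (p + 1).choose 3 = 1 := by
    rw [Nat.choose_succ_succ' p 2, pow_add, pow_choose_two_eq_one hp (by lia) hw,
      pow_choose_three_eq_one hp hp3 hw, one_mul]
  have := mul_pow_eq_of_commute (x := b) (y := a) (u := ⁅b, a⁆) (v := ⁅b, ⁅b, a⁆⁆)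
    (w := ⁅⁅b, a⁆, a⁆) (hmul b a) (hmul b ⁅b, a⁆) (hmul ⁅b, a⁆ a) hbb (aux hba hbb)
    hab haa (aux haa hab) p
  simpa [pow_choose_two_eq_one hp (by lia) hu, pow_choose_three_eq_one hp hp3 hv, hw'] using this

end Elementwise

section Modulo

open Subgroup

variable {G : Type*} [Group G] {R : Subgroup G} [R.Normal]

theorem commutator_le_iff_map_le_centralizer {H K : Subgroup G} :
    ⁅H, K⁆ ≤ R ↔
      H.map (QuotientGroup.mk' R) ≤ centralizer (K.map (QuotientGroup.mk' R) : Set (G ⧸ R)) := by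
  rw [← commutator_eq_bot_iff_le_centralizer, ← map_commutator, Subgroup.map_eq_bot_iff,
    QuotientGroup.ker_mk']

theorem sup_commutator_le {A B K : Subgroup G} (hA : ⁅A, K⁆ ≤ R) (hB : ⁅B, K⁆ ≤ R) :
    ⁅A ⊔ B, K⁆ ≤ R := by
  rw [commutator_le_iff_map_le_centralizer] at *
  rw [Subgroup.map_sup]
  exact sup_le hA hB

theorem closure_commutator_le {S : Set G} {K : Subgroup G}
    (h : ∀ s ∈ S, ∀ k ∈ K, ⁅s, k⁆ ∈ R) : ⁅closure S, K⁆ ≤ R := by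
  rw [commutator_le_iff_map_le_centralizer, MonoidHom.map_closure, closure_le]
  rintro _ ⟨s, hs, rfl⟩
  rw [SetLike.mem_coe, mem_centralizer_iff_commutator_eq_one]
  rintro _ ⟨k, hk, rfl⟩
  rw [← map_commutatorElement, ← MonoidHom.mem_ker, QuotientGroup.ker_mk',
    ← commutatorElement_inv]
  exact inv_mem (h s hs k hk)

/-- A normal subgroup of a nilpotent group contains `M` as soon as it does so modulo `[M, G]`. -/
theorem le_of_le_sup_commutator [Group.IsNilpotent G] {M : Subgroup G}
    (h : M ≤ R ⊔ ⁅M, (⊤ : Subgroup G)⁆) : M ≤ R := by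
  have key (n : ℕ) : M ≤ R ⊔ (⊤ : Subgroup G).lowerCentralSeries n := by
    induction n with
    | zero => simp
    | succ n ih =>
      refine h.trans (sup_le le_sup_left ((commutator_mono ih le_rfl).trans ?_))
      exact sup_commutator_le ((commutator_le_left R ⊤).trans le_sup_left)
        le_sup_right
  obtain ⟨n, hn⟩ := Subgroup.nilpotent_iff_lowerCentralSeries.1 ‹_›
  simpa [hn] using key n

end Modulo

section PowSubgroup

open Subgroup

variable {G : Type*} [Group G] {p : ℕ}

theorem pow_mem_powSubgroup {H : Subgroup G} {h : G} (hh : h ∈ H) (n : ℕ) :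
    h ^ n ∈ powSubgroup H n :=
  subset_closure ⟨h, hh, rfl⟩

theorem powSubgroup_le_iff {H K : Subgroup G} {n : ℕ} :
    powSubgroup H n ≤ K ↔ ∀ h ∈ H, h ^ n ∈ K := by
  refine ⟨fun h x hx ↦ h (pow_mem_powSubgroup hx n), fun h ↦ (closure_le _).2 ?_⟩
  rintro _ ⟨x, hx, rfl⟩
  exact h x hx

theorem powSubgroup_le_self (H : Subgroup G) (n : ℕ) : powSubgroup H n ≤ H :=
  powSubgroup_le_iff.2 fun _ hh ↦ pow_mem hh n

theorem powSubgroup_mono {H K : Subgroup G} (h : H ≤ K) (n : ℕ) :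
    powSubgroup H n ≤ powSubgroup K n :=
  powSubgroup_le_iff.2 fun _ hx ↦ pow_mem_powSubgroup (h hx) n

theorem map_powSubgroup {G' : Type*} [Group G'] (f : G →* G') (H : Subgroup G) (n : ℕ) :
    (powSubgroup H n).map f = powSubgroup (H.map f) n := by
  apply le_antisymm
  · rw [map_le_iff_le_comap, powSubgroup_le_iff]
    intro h hh
    rw [mem_comap, map_pow]
    exact pow_mem_powSubgroup (mem_map_of_mem f hh) n
  · rw [powSubgroup_le_iff]
    rintro _ ⟨h, hh, rfl⟩
    rw [← map_pow]
    exact mem_map_of_mem f (pow_mem_powSubgroup hh n)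

instance powSubgroup_normal (H : Subgroup G) [H.Normal] (n : ℕ) : (powSubgroup H n).Normal := by
  refine ⟨fun x hx g ↦ ?_⟩
  have h : H.map (MulAut.conj g).toMonoidHom ≤ H := by
    rintro _ ⟨h, hh, rfl⟩
    exact Subgroup.Normal.conj_mem ‹_› h hh g
  have hx' := mem_map_of_mem (MulAut.conj g).toMonoidHom hx
  rw [map_powSubgroup] at hx'
  exact powSubgroup_mono h n hx'

/-- In a nontrivial finite `p`-group the `p`-th powers generate a proper subgroup. -/
theorem powSubgroup_top_ne_top [Finite G] [Nontrivial G] (hp : p.Prime) (hG : IsPGroup p G) :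
    powSubgroup (⊤ : Subgroup G) p ≠ ⊤ := by
  have : Fact p.Prime := ⟨hp⟩
  obtain ⟨n, hn⟩ := IsPGroup.iff_card.1 hG
  have hn0 : n ≠ 0 := by
    rintro rfl
    exact Finite.one_lt_card.ne' (by simpa using hn)
  obtain ⟨m, rfl⟩ := Nat.exists_eq_succ_of_ne_zero hn0
  obtain ⟨K, hK⟩ := Sylow.exists_subgroup_card_pow_prime p (n := m) (G := G)
    (hn ▸ pow_dvd_pow p m.le_succ)
  have hidx : K.index = p := by
    have := K.card_mul_index
    rw [hK, hn, pow_succ] at this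
    exact Nat.eq_of_mul_eq_mul_left (pow_pos hp.pos m) this
  have : K.Normal := normal_of_index_eq_minFac_card (by
    rw [hidx, hn, hp.pow_minFac (Nat.succ_ne_zero m)])
  intro htop
  have hle : powSubgroup (⊤ : Subgroup G) p ≤ K := powSubgroup_le_iff.2 fun h _ ↦ by
    rw [← hidx]
    exact K.pow_index_mem h
  rw [htop, top_le_iff] at hle
  rw [hle, index_top] at hidx
  exact hp.one_lt.ne hidx

theorem not_le_powSubgroup [Finite G] (hp : p.Prime) (hG : IsPGroup p G) {C : Subgroup G}
    (hC : C ≠ ⊥) : ¬ C ≤ powSubgroup C p := by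
  intro h
  have : Nontrivial C := (nontrivial_iff_ne_bot C).2 hC
  refine powSubgroup_top_ne_top hp (hG.to_subgroup C) (eq_top_iff.2 ?_)
  rw [← map_subtype_le_map_subtype, map_powSubgroup, ← MonoidHom.range_eq_map, range_subtype]
  exact h

end PowSubgroup

section Descent

open Subgroup

variable {G : Type*} [Group G] {p : ℕ} {C : Subgroup G} [C.Normal]

/-- The subgroup `[C, G] C ^ p`. -/
def descent (C : Subgroup G) (p : ℕ) : Subgroup G :=
  ⁅C, (⊤ : Subgroup G)⁆ ⊔ powSubgroup C p

instance descent_normal (C : Subgroup G) [C.Normal] (p : ℕ) : (descent C p).Normal :=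
  inferInstanceAs (⁅C, (⊤ : Subgroup G)⁆ ⊔ powSubgroup C p).Normal

theorem descent_lt [Finite G] (hp : p.Prime) (hG : IsPGroup p G) (hC : C ≠ ⊥) :
    descent C p < C := by
  have : Fact p.Prime := ⟨hp⟩
  have := hG.isNilpotent
  refine lt_of_le_not_ge (sup_le (commutator_le_left _ _) (powSubgroup_le_self C p)) fun h ↦ ?_
  refine not_le_powSubgroup hp hG hC (le_of_le_sup_commutator ?_)
  rwa [sup_comm]

/-- If `[D, G] ≤ P ≤ D`, then modulo a normal subgroup containing `D ^ p` and `[P, G]` the `p`-th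
power is multiplicative on every pair whose commutator lies in `D`. -/
theorem mul_pow_prime_modulo (hp : p.Prime) (hp3 : 3 < p) {D P R : Subgroup G} [R.Normal]
    (hD : powSubgroup D p ≤ R) (hDP : ⁅D, (⊤ : Subgroup G)⁆ ≤ P) (hPD : P ≤ D)
    (hP : ⁅P, (⊤ : Subgroup G)⁆ ≤ R) {a b : G} (hab : ⁅b, a⁆ ∈ D) :
    (((a * b) ^ p : G) : G ⧸ R) = ((a ^ p : G) : G ⧸ R) * ((b ^ p : G) : G ⧸ R) := by
  have hpow {z : G} (hz : z ∈ D) : (z : G ⧸ R) ^ p = 1 := by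
    rw [← QuotientGroup.mk_pow, QuotientGroup.eq_one_iff]
    exact hD (pow_mem_powSubgroup hz p)
  have hcomm {z : G} (hz : z ∈ P) (g : G) : Commute (z : G ⧸ R) g := by
    rw [← commutatorElement_eq_one_iff_commute]
    exact (QuotientGroup.eq_one_iff _).2 (hP (commutator_mem_commutator hz (mem_top g)))
  have hw : ⁅⁅b, a⁆, a⁆ ∈ P := hDP (commutator_mem_commutator hab (mem_top a))
  have hv : ⁅b, ⁅b, a⁆⁆ ∈ P := by
    rw [← commutatorElement_inv]
    exact inv_mem (hDP (commutator_mem_commutator hab (mem_top b)))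
  exact mul_pow_prime_of_commute_of_commute (a := (a : G ⧸ R)) (b := (b : G ⧸ R)) hp hp3
    (hcomm hv a) (hcomm hv b) (hcomm hw a) (hcomm hw b) (hpow hab) (hpow (hPD hv)) (hpow (hPD hw))

theorem commutator_descent_le (hC : ⁅⁅C, (⊤ : Subgroup G)⁆, (⊤ : Subgroup G)⁆ ≤ powSubgroup C p) :
    ⁅descent C p, (⊤ : Subgroup G)⁆ ≤ powSubgroup C p :=
  sup_commutator_le hC (commutator_le_left _ _)

theorem commutator_powSubgroup_le [Finite G] (hp : p.Prime) (hp3 : 3 < p) (hG : IsPGroup p G)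
    (hC : ⁅⁅C, (⊤ : Subgroup G)⁆, (⊤ : Subgroup G)⁆ ≤ powSubgroup C p) :
    ⁅powSubgroup C p, (⊤ : Subgroup G)⁆ ≤ powSubgroup (descent C p) p := by
  have : Fact p.Prime := ⟨hp⟩
  have := hG.isNilpotent
  apply le_of_le_sup_commutator
  refine closure_commutator_le ?_
  rintro _ ⟨y, hy, rfl⟩ g -
  have hu : ⁅y, g⁆ ∈ descent C p :=
    mem_sup_left (commutator_mem_commutator hy (mem_top g))
  have hb : ⁅g * y * g⁻¹, ⁅y, g⁆⁆ ∈ powSubgroup C p := by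
    rw [← commutatorElement_inv]
    exact inv_mem (commutator_descent_le hC (commutator_mem_commutator hu (mem_top _)))
  have key := mul_pow_prime_modulo (D := powSubgroup C p)
    (P := ⁅powSubgroup C p, (⊤ : Subgroup G)⁆) (R := powSubgroup (descent C p) p ⊔
      ⁅⁅powSubgroup C p, (⊤ : Subgroup G)⁆, (⊤ : Subgroup G)⁆) hp hp3
    ((powSubgroup_mono le_sup_right p).trans le_sup_left) le_rfl (commutator_le_left _ _)
    le_sup_right hb
  have hy' : ⁅y, g⁆ * (g * y * g⁻¹) = y := by simp [commutatorElement_def, mul_assoc]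
  have hone : ((⁅y, g⁆ ^ p : G) : G ⧸ powSubgroup (descent C p) p ⊔
      ⁅⁅powSubgroup C p, (⊤ : Subgroup G)⁆, (⊤ : Subgroup G)⁆) = 1 :=
    (QuotientGroup.eq_one_iff _).2 (mem_sup_left (pow_mem_powSubgroup hu p))
  rw [hy', hone, one_mul, conj_pow] at key
  have hcomm : ⁅y ^ p, g⁆ = y ^ p * (g * y ^ p * g⁻¹)⁻¹ := by
    simp [commutatorElement_def, mul_assoc]
  rw [hcomm, ← QuotientGroup.eq_one_iff, QuotientGroup.mk_mul, QuotientGroup.mk_inv, key,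
    mul_inv_cancel]

/-- If `[C, G, G] ≤ C ^ p`, every coset of `C` that contains an element with `p`-th power in
`C ^ p` contains an element of order dividing `p`. -/
theorem exists_mul_pow_eq_one [Finite G] (hp : p.Prime) (hp3 : 3 < p) (hG : IsPGroup p G)
    (hC : ⁅⁅C, (⊤ : Subgroup G)⁆, (⊤ : Subgroup G)⁆ ≤ powSubgroup C p) {x : G}
    (hx : x ^ p ∈ powSubgroup C p) : ∃ c ∈ C, (c * x) ^ p = 1 := by
  induction hn : Nat.card C using Nat.strong_induction_on generalizing C x with
  | _ n ih =>
  subst hn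
  by_cases hbot : C = ⊥
  · refine ⟨1, one_mem C, ?_⟩
    rw [one_mul, ← mem_bot, ← hbot]
    exact powSubgroup_le_self C p hx
  have hlt := descent_lt hp hG hbot
  have hPG := commutator_powSubgroup_le hp hp3 hG hC
  have hmul {a b : G} (hab : ⁅b, a⁆ ∈ descent C p) := mul_pow_prime_modulo hp hp3 le_rfl
    (commutator_descent_le hC) le_sup_right hPG hab
  have hdesc {c : G} (hc : c ∈ C) (g : G) : ⁅g, c⁆ ∈ descent C p := by
    rw [← commutatorElement_inv]
    exact mem_sup_left (inv_mem (commutator_mem_commutator hc (mem_top g)))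
  have hroot {z : G} (hz : z ∈ powSubgroup C p) :
      ∃ c ∈ C, ((c ^ p : G) : G ⧸ powSubgroup (descent C p) p) = z := by
    induction hz using closure_induction with
    | mem _ h =>
      obtain ⟨c, hc, rfl⟩ := h
      exact ⟨c, hc, rfl⟩
    | one => exact ⟨1, one_mem C, by simp⟩
    | mul _ _ _ _ ha hb =>
      obtain ⟨a, ha, ha'⟩ := ha
      obtain ⟨b, hb, hb'⟩ := hb
      exact ⟨a * b, mul_mem ha hb, by rw [hmul (hdesc ha b), ha', hb', QuotientGroup.mk_mul]⟩
    | inv _ _ ha =>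
      obtain ⟨a, ha, ha'⟩ := ha
      exact ⟨a⁻¹, inv_mem ha, by rw [inv_pow, QuotientGroup.mk_inv, ha', QuotientGroup.mk_inv]⟩
  obtain ⟨c, hc, hcx⟩ := hroot (inv_mem hx)
  have hcx' : (c * x) ^ p ∈ powSubgroup (descent C p) p := by
    rw [← QuotientGroup.eq_one_iff, hmul (hdesc hc x), hcx, ← QuotientGroup.mk_mul,
      inv_mul_cancel, QuotientGroup.mk_one]
  obtain ⟨d, hd, hdx⟩ := ih _ (Set.Finite.card_lt_card (Set.toFinite _) hlt)
    ((commutator_mono (commutator_descent_le hC) le_rfl).trans hPG) hcx' rfl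
  exact ⟨d * c, mul_mem (hlt.le hd) hc, by rwa [mul_assoc]⟩

end Descent

section Pairing

open Subgroup

variable {Q : Type*} [Group Q] {p : ℕ}

/-- The subgroup `H ^ p [H, H]`. -/
def powCommutator (H : Subgroup Q) (p : ℕ) : Subgroup Q :=
  powSubgroup H p ⊔ ⁅H, H⁆

instance powCommutator_normal (H : Subgroup Q) [H.Normal] (p : ℕ) : (powCommutator H p).Normal :=
  inferInstanceAs (powSubgroup H p ⊔ ⁅H, H⁆).Normal

theorem map_powCommutator {Q' : Type*} [Group Q'] (f : Q →* Q') (H : Subgroup Q) (p : ℕ) :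
    (powCommutator H p).map f = powCommutator (H.map f) p := by
  simp only [powCommutator, Subgroup.map_sup, map_powSubgroup, map_commutator]

theorem pow_mem_powCommutator_top (g : Q) (p : ℕ) : g ^ p ∈ powCommutator (⊤ : Subgroup Q) p :=
  mem_sup_left (pow_mem_powSubgroup (mem_top g) p)

theorem commutatorElement_mem_powCommutator_top (a b : Q) (p : ℕ) :
    ⁅a, b⁆ ∈ powCommutator (⊤ : Subgroup Q) p :=
  mem_sup_right (commutator_mem_commutator (mem_top a) (mem_top b))

theorem commutatorElement_mul_right_of_mem_center {f g h : Q} (hc : ⁅f, h⁆ ∈ center Q) :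
    ⁅f, g * h⁆ = ⁅f, g⁆ * ⁅f, h⁆ := by
  have : ⁅f, g * h⁆ = ⁅f, g⁆ * (g * ⁅f, h⁆ * g⁻¹) := by simp [commutatorElement_def, mul_assoc]
  rw [this, mem_center_iff.1 hc g, mul_inv_cancel_right]

theorem commutatorElement_mul_left_of_mem_center {f g h : Q} (hc : ⁅g, h⁆ ∈ center Q) :
    ⁅f * g, h⁆ = ⁅f, h⁆ * ⁅g, h⁆ := by
  have : ⁅f * g, h⁆ = f * ⁅g, h⁆ * f⁻¹ * ⁅f, h⁆ := by simp [commutatorElement_def, mul_assoc]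
  rw [this, mem_center_iff.1 hc f, mul_inv_cancel_right, mem_center_iff.1 hc]

/-- A finite group has at most as many linear characters as elements. -/
theorem card_monoidHom_units_le (W : Type*) [Group W] [Finite W] :
    Nat.card (W →* ℂˣ) ≤ Nat.card W := by
  rw [Nat.card_congr Abelianization.lift,
    CommGroup.card_monoidHom_of_hasEnoughRootsOfUnity (Abelianization W) ℂ]
  exact Nat.card_le_card_of_surjective _ (QuotientGroup.mk'_surjective (commutator W))

theorem exists_injective_monoidHom_units {Z : Type*} [CommGroup Z] (hp : p.Prime)
    (hZ : Nat.card Z = p) : ∃ χ : Z →* ℂˣ, Function.Injective χ := by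
  have : Fact p.Prime := ⟨hp⟩
  have : Finite Z := Nat.finite_of_card_ne_zero (hZ ▸ hp.ne_zero)
  have : Nontrivial Z := Finite.one_lt_card_iff_nontrivial.1 (hZ ▸ hp.one_lt)
  obtain ⟨z, hz⟩ := exists_ne (1 : Z)
  obtain ⟨χ, hχ⟩ := CommGroup.exists_apply_ne_one_of_hasEnoughRootsOfUnity Z ℂ hz
  refine ⟨χ, (MonoidHom.ker_eq_bot_iff χ).1 ?_⟩
  have : Fact (Nat.card Z).Prime := ⟨hZ ▸ hp⟩
  refine (eq_bot_or_eq_top_of_prime_card χ.ker).resolve_right fun h ↦ hχ ?_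
  exact (MonoidHom.mem_ker).1 (h ▸ mem_top z)

theorem index_centralizer_le_relIndex_center [Finite Q] (hp : p.Prime) {F : Subgroup Q}
    (hZ : ⁅F, (⊤ : Subgroup Q)⁆ ≤ center Q) (hcard : Nat.card (⁅F, ⊤⁆ : Subgroup Q) = p) :
    (centralizer (F : Set Q)).index ≤ (center Q).relIndex F := by
  have hmem (f : F) (g : Q) : ⁅(f : Q), g⁆ ∈ ⁅F, (⊤ : Subgroup Q)⁆ :=
    commutator_mem_commutator f.2 (mem_top g)
  let : CommGroup (⁅F, ⊤⁆ : Subgroup Q) :=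
    { (inferInstance : Group (⁅F, ⊤⁆ : Subgroup Q)) with
      mul_comm := fun a b ↦ Subtype.ext (mem_center_iff.1 (hZ b.2) a) }
  obtain ⟨χ, hχ⟩ := exists_injective_monoidHom_units hp hcard
  let B (g : Q) : F →* ℂˣ := MonoidHom.mk' (fun f ↦ χ ⟨⁅(f : Q), g⁆, hmem f g⟩) fun a b ↦ by
    rw [← map_mul]
    exact congrArg χ (Subtype.ext (commutatorElement_mul_left_of_mem_center (hZ (hmem b g))))
  have hB (g : Q) (f : F) : B g f = χ ⟨⁅(f : Q), g⁆, hmem f g⟩ := rfl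
  have hB1 (g : Q) (f : F) : B g f = 1 ↔ ⁅(f : Q), g⁆ = 1 := by
    rw [hB, map_eq_one_iff χ hχ, Subtype.ext_iff]
    rfl
  let Ψ : Q →* (F ⧸ (center Q).subgroupOf F →* ℂˣ) :=
    MonoidHom.mk' (fun g ↦ QuotientGroup.lift _ (B g) fun f hf ↦ (hB1 g f).2
      (commutatorElement_eq_one_iff_mul_comm.2 (mem_center_iff.1 (mem_subgroupOf.1 hf) g).symm))
      fun g h ↦ by
        refine QuotientGroup.monoidHom_ext _ (MonoidHom.ext fun f ↦ ?_)
        change B (g * h) f = B g f * B h f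
        rw [hB, hB, hB, ← map_mul]
        exact congrArg χ (Subtype.ext (commutatorElement_mul_right_of_mem_center (hZ (hmem f h))))
  have hker : Ψ.ker ≤ centralizer (F : Set Q) := fun g hg ↦ by
    refine mem_centralizer_iff.2 fun f hf ↦ commutatorElement_eq_one_iff_mul_comm.1
      ((hB1 g ⟨f, hf⟩).1 ?_)
    exact DFunLike.congr_fun ((MonoidHom.mem_ker).1 hg) (QuotientGroup.mk (⟨f, hf⟩ : F))
  have : Finite (F ⧸ (center Q).subgroupOf F →* ℂˣ) := by
    refine Finite.of_equiv _ Abelianization.lift.symm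
  calc (centralizer (F : Set Q)).index ≤ Ψ.ker.index :=
        Nat.le_of_dvd (Nat.pos_of_ne_zero index_ne_zero_of_finite) (index_dvd_of_le hker)
    _ = Nat.card Ψ.range := index_ker Ψ
    _ ≤ Nat.card (F ⧸ (center Q).subgroupOf F →* ℂˣ) := card_le_card_group _
    _ ≤ Nat.card (F ⧸ (center Q).subgroupOf F) := card_monoidHom_units_le _

theorem powCommutator_top_le_centralizer
    (hZ : ⁅powCommutator (⊤ : Subgroup Q) p, (⊤ : Subgroup Q)⁆ ≤ center Q)
    (hpow : ∀ z ∈ ⁅powCommutator (⊤ : Subgroup Q) p, (⊤ : Subgroup Q)⁆, z ^ p = 1) :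
    powCommutator (⊤ : Subgroup Q) p ≤
      centralizer (powCommutator (⊤ : Subgroup Q) p : Set Q) := by
  have hbot : ⁅⁅powCommutator (⊤ : Subgroup Q) p, (⊤ : Subgroup Q)⁆, (⊤ : Subgroup Q)⁆ = ⊥ := by
    rwa [commutator_eq_bot_iff_le_centralizer, coe_top, centralizer_univ]
  refine sup_le (powSubgroup_le_iff.2 fun g _ ↦ ?_) ?_
  · refine mem_centralizer_iff.2 fun f hf ↦ commutatorElement_eq_one_iff_mul_comm.1 ?_
    have hm := commutator_mem_commutator hf (mem_top g)
    rw [commutatorElement_pow_right_of_commute (mem_center_iff.1 (hZ hm) g).symm, hpow _ hm]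
  · rw [← commutator_eq_bot_iff_le_centralizer]
    exact commutator_commutator_eq_bot_of_rotate (by rwa [commutator_comm ⊤ (powCommutator _ _)])
      hbot

theorem powCommutator_centralizer_le_center (hp : p.Prime) (hp2 : 2 < p)
    (hZ : ⁅powCommutator (⊤ : Subgroup Q) p, (⊤ : Subgroup Q)⁆ ≤ center Q)
    (hpow : ∀ z ∈ ⁅powCommutator (⊤ : Subgroup Q) p, (⊤ : Subgroup Q)⁆, z ^ p = 1) :
    powCommutator (centralizer (powCommutator (⊤ : Subgroup Q) p : Set Q)) p ≤ center Q := by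
  set F := powCommutator (⊤ : Subgroup Q) p with hF
  have hcomm {c f : Q} (hc : c ∈ centralizer (F : Set Q)) (hf : f ∈ F) : Commute c f :=
    (mem_centralizer_iff.1 hc f hf).symm
  refine sup_le (powSubgroup_le_iff.2 fun c hc ↦ mem_center_iff.2 fun x ↦ ?_) ?_
  · have hu : ⁅c, x⁆ ∈ F := commutatorElement_mem_powCommutator_top c x p
    have hz : ⁅x, ⁅c, x⁆⁆ ∈ ⁅F, (⊤ : Subgroup Q)⁆ := by
      rw [commutator_comm]
      exact commutator_mem_commutator (mem_top x) hu
    have hxp : Commute c (x ^ p) := hcomm hc (pow_mem_powCommutator_top x p)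
    have hconj : ⁅c, x⁆ * x = c * x * c⁻¹ := by simp [commutatorElement_def]
    have hmul := mul_pow_prime_of_commute hp hp2 (mem_center_iff.1 (hZ hz) _).symm
      (mem_center_iff.1 (hZ hz) _).symm (hpow _ hz)
    rw [hconj, conj_pow, hxp.eq, mul_inv_cancel_right, right_eq_mul] at hmul
    rw [← commutatorElement_pow_left_of_commute (hcomm hc hu).symm,
      commutatorElement_eq_one_iff_mul_comm] at hmul
    exact hmul.symm
  · have hle {H K : Subgroup Q} : ⁅H, K⁆ ≤ F := fun x hx ↦
      mem_sup_right (commutator_mono le_top le_top hx)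
    rw [← centralizer_univ, ← coe_top, ← commutator_eq_bot_iff_le_centralizer]
    refine commutator_commutator_eq_bot_of_rotate ?_ ?_ <;>
    · rw [commutator_comm, commutator_eq_bot_iff_le_centralizer]
      exact centralizer_le (SetLike.coe_subset_coe.2 hle)

end Pairing

section Thompson

open Subgroup

variable {G : Type*} [Group G] {p : ℕ}

theorem powCommutator_mono {H K : Subgroup G} (h : H ≤ K) (p : ℕ) :
    powCommutator H p ≤ powCommutator K p :=
  sup_le_sup (powSubgroup_mono h p) (commutator_mono h h)

theorem exists_normal_relIndex_eq_prime [Finite G] (hp : p.Prime) (hG : IsPGroup p G)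
    {M : Subgroup G} [M.Normal] (hM : M ≠ ⊥) :
    ∃ N : Subgroup G, N.Normal ∧ ⁅M, (⊤ : Subgroup G)⁆ ≤ N ∧ N ≤ M ∧ N.relIndex M = p := by
  have : Fact p.Prime := ⟨hp⟩
  have := hG.isNilpotent
  have hlt : ⁅M, (⊤ : Subgroup G)⁆ < M := by
    refine lt_of_le_not_ge (commutator_le_left _ _) fun h ↦ hM (le_bot_iff.1 ?_)
    exact le_of_le_sup_commutator (by rwa [bot_sup_eq])
  obtain ⟨m, hm⟩ := IsPGroup.iff_card.1 (hG.to_subgroup M)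
  obtain ⟨k, hk⟩ := IsPGroup.iff_card.1 (hG.to_subgroup ⁅M, (⊤ : Subgroup G)⁆)
  have hkm : k < m := by
    rw [← Nat.pow_lt_pow_iff_right hp.one_lt, ← hk, ← hm]
    exact Set.Finite.card_lt_card (Set.toFinite _) hlt
  obtain ⟨n, rfl⟩ := Nat.exists_eq_add_of_lt hkm
  have hk' : Nat.card (⁅M, (⊤ : Subgroup G)⁆.subgroupOf M) = p ^ k := by
    rw [← hk]
    exact Nat.card_congr (subgroupOfEquivOfLe hlt.le).toEquiv
  obtain ⟨N, hN, hle⟩ := Sylow.exists_subgroup_card_pow_prime_le p (m := k + n)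
    (hm ▸ pow_dvd_pow p (Nat.le_succ _)) _ hk' (Nat.le_add_right k n)
  have hMN : ⁅M, (⊤ : Subgroup G)⁆ ≤ N.map M.subtype := by
    have := map_mono (f := M.subtype) hle
    rwa [subgroupOf_map_subtype, inf_eq_left.2 hlt.le] at this
  have hNM : N.map M.subtype ≤ M := map_subtype_le N
  refine ⟨N.map M.subtype, ?_, hMN, hNM, ?_⟩
  · exact commutator_top_right_le_iff.1 ((commutator_mono hNM le_rfl).trans hMN)
  · have h := relIndex_mul_relIndex ⊥ (N.map M.subtype) M bot_le hNM
    rw [relIndex_bot_left, relIndex_bot_left, hm, card_map_of_injective M.subtype_injective, hN,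
      pow_succ] at h
    exact Nat.eq_of_mul_eq_mul_left (pow_pos hp.pos _) h

/-- If the Frattini subgroup `Φ` of a finite `p`-group `G` is not central, there are a proper normal
subgroup `C` containing `Φ` and a subgroup `S` of `Φ` containing `[Φ, G]` and `C ^ p [C, C]` such
that `|G : C| ≤ |Φ : S|`. -/
theorem exists_index_le_relIndex [Finite G] (hp : p.Prime) (hp2 : 2 < p) (hG : IsPGroup p G)
    (hM : ⁅powCommutator (⊤ : Subgroup G) p, (⊤ : Subgroup G)⁆ ≠ ⊥) :
    ∃ C S : Subgroup G, C.Normal ∧ C ≠ ⊤ ∧ powCommutator ⊤ p ≤ C ∧ S ≤ powCommutator ⊤ p ∧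
      ⁅powCommutator (⊤ : Subgroup G) p, (⊤ : Subgroup G)⁆ ≤ S ∧ powCommutator C p ≤ S ∧
      C.index ≤ S.relIndex (powCommutator ⊤ p) := by
  obtain ⟨N, _, hMN, -, hidx⟩ := exists_normal_relIndex_eq_prime hp hG hM
  have hsurj := QuotientGroup.mk'_surjective N
  have hF : (powCommutator ⊤ p).map (QuotientGroup.mk' N) = powCommutator ⊤ p := by
    rw [map_powCommutator, map_top_of_surjective _ hsurj]
  have hFM : ⁅powCommutator (⊤ : Subgroup G) p, (⊤ : Subgroup G)⁆.map (QuotientGroup.mk' N) =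
      ⁅powCommutator (⊤ : Subgroup (G ⧸ N)) p, (⊤ : Subgroup (G ⧸ N))⁆ := by
    rw [map_commutator, hF, map_top_of_surjective _ hsurj]
  have hZ : ⁅powCommutator (⊤ : Subgroup (G ⧸ N)) p, (⊤ : Subgroup (G ⧸ N))⁆ ≤ center (G ⧸ N) := by
    rw [commutator_le_iff_map_le_centralizer, hFM, map_top_of_surjective _ hsurj, coe_top,
      centralizer_univ] at hMN
    exact hMN
  have hcard :
      Nat.card (⁅powCommutator (⊤ : Subgroup (G ⧸ N)) p, ⊤⁆ : Subgroup (G ⧸ N)) = p := by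
    rw [← hFM, ← relIndex_ker, QuotientGroup.ker_mk', hidx]
  have hpow : ∀ z ∈ ⁅powCommutator (⊤ : Subgroup (G ⧸ N)) p, (⊤ : Subgroup (G ⧸ N))⁆,
      z ^ p = 1 := fun z hz ↦ by
    have := pow_card_eq_one' (x := (⟨z, hz⟩ :
      (⁅powCommutator (⊤ : Subgroup (G ⧸ N)) p, ⊤⁆ : Subgroup (G ⧸ N))))
    rw [hcard] at this
    exact congrArg Subtype.val this
  refine ⟨(centralizer (powCommutator (⊤ : Subgroup (G ⧸ N)) p : Set (G ⧸ N))).comap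
    (QuotientGroup.mk' N), (center (G ⧸ N)).comap (QuotientGroup.mk' N) ⊓ powCommutator ⊤ p,
    inferInstance, ?_, ?_, inf_le_right, le_inf ?_ (commutator_le_left _ _), le_inf ?_ ?_, ?_⟩
  · intro htop
    have h : ⁅powCommutator (⊤ : Subgroup (G ⧸ N)) p, (⊤ : Subgroup (G ⧸ N))⁆ = ⊥ := by
      rw [commutator_comm, commutator_eq_bot_iff_le_centralizer,
        comap_injective hsurj (htop.trans (comap_top _).symm)]
    rw [h, card_bot] at hcard
    exact hp.one_lt.ne hcard
  · rw [← map_le_iff_le_comap, hF]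
    exact powCommutator_top_le_centralizer hZ hpow
  · rwa [← map_le_iff_le_comap, hFM]
  · rw [← map_le_iff_le_comap, map_powCommutator]
    exact (powCommutator_mono (map_comap_le _ _) p).trans
      (powCommutator_centralizer_le_center hp hp2 hZ hpow)
  · exact powCommutator_mono le_top p
  · rw [index_comap_of_surjective _ hsurj, inf_relIndex_right, relIndex_comap, hF]
    exact index_centralizer_le_relIndex_center hp hZ hcard

end Thompson

section Counting

open Subgroup

theorem le_of_relIndex_le {G : Type*} [Group G] [Finite G] {H K L : Subgroup G} (hHK : H ≤ K)
    (hKL : K ≤ L) (h : H.relIndex L ≤ K.relIndex L) : K ≤ H := by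
  rw [← relIndex_mul_relIndex H K L hHK hKL] at h
  have hH : H.relIndex K ≠ 0 := index_ne_zero_of_finite
  have hK : 0 < K.relIndex L := Nat.pos_of_ne_zero index_ne_zero_of_finite
  rw [← relIndex_eq_one]
  nlinarith [Nat.pos_of_ne_zero hH]

theorem index_powCommutator_top {G : Type*} [Group G] (C : Subgroup G) (p : ℕ) :
    (powCommutator (⊤ : Subgroup C) p).index = (powCommutator C p).relIndex C := by
  have h := map_powCommutator C.subtype ⊤ p
  rw [← MonoidHom.range_eq_map, range_subtype] at h
  rw [← h, relIndex, subgroupOf, comap_map_eq_self_of_injective C.subtype_injective]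

theorem ncard_inter_subgroup {G : Type*} [Group G] (C : Subgroup G) (p : ℕ) :
    Nat.card {c : C | c ^ p = 1} = ({g : G | g ^ p = 1} ∩ C).ncard := by
  rw [Nat.card_coe_set_eq, ← Set.ncard_image_of_injective {c : C | c ^ p = 1} C.subtype_injective]
  congr 1
  ext g
  constructor
  · rintro ⟨c, hc, rfl⟩
    exact ⟨congrArg Subtype.val hc, c.2⟩
  · rintro ⟨hg, hgC⟩
    exact ⟨⟨g, hgC⟩, Subtype.ext hg, rfl⟩

/-- If the Frattini subgroup is central, the `p`-th powers form a subgroup of the expected index. -/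
theorem index_powSubgroup_top {G : Type*} [Group G] [Finite G] {p : ℕ} (hp : p.Prime) (hp2 : 2 < p)
    (hM : ⁅powCommutator (⊤ : Subgroup G) p, (⊤ : Subgroup G)⁆ = ⊥) :
    (powSubgroup (⊤ : Subgroup G) p).index = Nat.card {g : G | g ^ p = 1} := by
  have hcomm {f : G} (hf : f ∈ powCommutator ⊤ p) (g : G) : Commute f g := by
    rw [← commutatorElement_eq_one_iff_commute, ← mem_bot, ← hM]
    exact commutator_mem_commutator hf (mem_top g)
  let π : G →* G := MonoidHom.mk' (· ^ p) fun a b ↦ by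
    have hba := commutatorElement_mem_powCommutator_top b a p
    refine mul_pow_prime_of_commute hp hp2 (hcomm hba a) (hcomm hba b) ?_
    rw [← commutatorElement_pow_left_of_commute (hcomm hba b),
      commutatorElement_eq_one_iff_commute]
    exact hcomm (pow_mem_powCommutator_top b p) a
  have hrange : powSubgroup ⊤ p = π.range := by
    refine le_antisymm (powSubgroup_le_iff.2 fun g _ ↦ ⟨g, rfl⟩) ?_
    rintro _ ⟨g, rfl⟩
    exact pow_mem_powSubgroup (mem_top g) p
  have hker : Nat.card {g : G | g ^ p = 1} = Nat.card π.ker := rfl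
  have h := π.ker.card_mul_index.trans π.range.card_mul_index.symm
  rw [index_ker, mul_comm] at h
  rw [hrange, hker]
  exact (Nat.eq_of_mul_eq_mul_left Nat.card_pos h).symm

theorem index_le_relIndex {G : Type*} [Group G] {C F S : Subgroup G} (hFC : F ≤ C) (hSF : S ≤ F)
    (h : C.index ≤ S.relIndex F) : F.index ≤ S.relIndex C := by
  rw [← relIndex_mul_index hFC, ← relIndex_mul_relIndex S F C hSF hFC, mul_comm]
  exact Nat.mul_le_mul_right _ h

theorem card_lt_card_of_ne_top {G : Type*} [Group G] [Finite G] {C : Subgroup G} (hC : C ≠ ⊤) :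
    Nat.card C < Nat.card G := by
  rw [← card_top (G := G)]
  exact Set.Finite.card_lt_card (Set.toFinite _)
    (SetLike.coe_ssubset_coe.2 (lt_top_iff_ne_top.2 hC))

/-- The order of the Frattini quotient of a finite `p`-group, `p` odd, is at most the number of
solutions of `x ^ p = 1`. -/
theorem index_powCommutator_le {G : Type*} [Group G] [Finite G] {p : ℕ} (hp : p.Prime)
    (hp2 : 2 < p) (hG : IsPGroup p G) :
    (powCommutator (⊤ : Subgroup G) p).index ≤ Nat.card {g : G | g ^ p = 1} := by
  induction hn : Nat.card G using Nat.strong_induction_on generalizing G with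
  | _ n ih =>
  subst hn
  by_cases hM : ⁅powCommutator (⊤ : Subgroup G) p, (⊤ : Subgroup G)⁆ = ⊥
  · rw [← index_powSubgroup_top hp hp2 hM]
    exact Nat.le_of_dvd (Nat.pos_of_ne_zero index_ne_zero_of_finite) (index_dvd_of_le le_sup_left)
  obtain ⟨C, S, _, hC, hFC, hSF, -, hCS, hidx⟩ := exists_index_le_relIndex hp hp2 hG hM
  calc (powCommutator (⊤ : Subgroup G) p).index ≤ S.relIndex C := index_le_relIndex hFC hSF hidx
    _ ≤ (powCommutator C p).relIndex C := relIndex_le_of_le_left hCS index_ne_zero_of_finite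
    _ = (powCommutator (⊤ : Subgroup C) p).index := (index_powCommutator_top C p).symm
    _ ≤ Nat.card {c : C | c ^ p = 1} :=
        ih _ (card_lt_card_of_ne_top hC) (hG.to_subgroup C) rfl
    _ = ({g : G | g ^ p = 1} ∩ C).ncard := ncard_inter_subgroup C p
    _ ≤ {g : G | g ^ p = 1}.ncard := Set.ncard_le_ncard Set.inter_subset_left

/-- If `C ^ p` contains `[Φ, G]`, where `Φ` is the Frattini subgroup, every solution of `x ^ p = 1`
lies in `C`, and `|C : C ^ p| = |G : Φ|`, then `Φ = G ^ p`. -/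
theorem powCommutator_top_le_of_relIndex_eq {G : Type*} [Group G] [Finite G] {p : ℕ}
    (hp : p.Prime) (hp3 : 3 < p) (hG : IsPGroup p G) {C : Subgroup G} [C.Normal]
    (hFC : powCommutator ⊤ p ≤ C)
    (hF : ⁅powCommutator (⊤ : Subgroup G) p, (⊤ : Subgroup G)⁆ ≤ powSubgroup C p)
    (hΩ : ∀ g : G, g ^ p = 1 → g ∈ C)
    (hidx : (powSubgroup C p).relIndex C = (powCommutator (⊤ : Subgroup G) p).index) :
    powCommutator (⊤ : Subgroup G) p ≤ powSubgroup ⊤ p := by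
  have hcomm {f : G} (hf : f ∈ powCommutator ⊤ p) (g : G) :
      Commute (f : G ⧸ powSubgroup C p) g := by
    rw [← commutatorElement_eq_one_iff_commute]
    exact (QuotientGroup.eq_one_iff _).2 (hF (commutator_mem_commutator hf (mem_top g)))
  let φ : G →* G ⧸ powSubgroup C p := MonoidHom.mk' (fun x ↦ (x : G ⧸ powSubgroup C p) ^ p)
    fun a b ↦ by
      have hba := commutatorElement_mem_powCommutator_top b a p
      refine mul_pow_prime_of_commute (a := (a : G ⧸ powSubgroup C p))
        (b := (b : G ⧸ powSubgroup C p)) hp (by omega) (hcomm hba a) (hcomm hba b) ?_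
      exact (QuotientGroup.eq_one_iff (⁅b, a⁆ ^ p)).2 (pow_mem_powSubgroup (hFC hba) p)
  have hker : φ.ker ≤ C := fun x hx ↦ by
    have hxp : x ^ p ∈ powSubgroup C p := (QuotientGroup.eq_one_iff (x ^ p)).1 hx
    obtain ⟨c, hc, hcx⟩ := exists_mul_pow_eq_one hp hp3 hG
      ((commutator_mono ((commutator_mono le_top le_rfl).trans le_sup_right) le_rfl).trans hF) hxp
    exact (mul_mem_cancel_left hc).1 (hΩ _ hcx)
  have hrange : φ.range ≤ (powSubgroup ⊤ p).map (QuotientGroup.mk' (powSubgroup C p)) := by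
    rintro _ ⟨x, rfl⟩
    exact ⟨x ^ p, pow_mem_powSubgroup (mem_top x) p, rfl⟩
  have hC : C.index ≤ (powSubgroup C p).relIndex (powSubgroup ⊤ p) :=
    calc C.index ≤ φ.ker.index :=
          Nat.le_of_dvd (Nat.pos_of_ne_zero index_ne_zero_of_finite) (index_dvd_of_le hker)
      _ = Nat.card φ.range := index_ker φ
      _ ≤ Nat.card ((powSubgroup ⊤ p).map (QuotientGroup.mk' (powSubgroup C p))) :=
          card_le_of_le hrange
      _ = (powSubgroup C p).relIndex (powSubgroup ⊤ p) := by
          rw [← relIndex_ker, QuotientGroup.ker_mk']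
  have hle : powSubgroup (⊤ : Subgroup G) p ≤ powCommutator ⊤ p := le_sup_left
  refine le_of_relIndex_le hle le_top ?_
  rw [relIndex_top_right, relIndex_top_right, ← hidx]
  exact index_le_relIndex (hle.trans hFC) (powSubgroup_mono le_top p) hC

theorem powCommutator_top_le_powSubgroup {G : Type*} [Group G] [Finite G] {p : ℕ} (hp : p.Prime)
    (hp3 : 3 < p) (hG : IsPGroup p G)
    (h : (powCommutator (⊤ : Subgroup G) p).index = Nat.card {g : G | g ^ p = 1}) :
    powCommutator (⊤ : Subgroup G) p ≤ powSubgroup ⊤ p := by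
  induction hn : Nat.card G using Nat.strong_induction_on generalizing G with
  | _ n ih =>
  subst hn
  have hp2 : 2 < p := by omega
  by_cases hM : ⁅powCommutator (⊤ : Subgroup G) p, (⊤ : Subgroup G)⁆ = ⊥
  · refine le_of_relIndex_le le_sup_left le_top ?_
    rw [relIndex_top_right, relIndex_top_right, h, index_powSubgroup_top hp hp2 hM]
  obtain ⟨C, S, _, hC, hFC, hSF, hFS, hCS, hidx⟩ := exists_index_le_relIndex hp hp2 hG hM
  have h₁ : (powCommutator (⊤ : Subgroup G) p).index ≤ S.relIndex C :=
    index_le_relIndex hFC hSF hidx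
  have h₂ : S.relIndex C ≤ (powCommutator C p).relIndex C :=
    relIndex_le_of_le_left hCS index_ne_zero_of_finite
  have h₃ := index_powCommutator_le hp hp2 (hG.to_subgroup C)
  have h₄ : ({g : G | g ^ p = 1} ∩ C).ncard ≤ {g : G | g ^ p = 1}.ncard :=
    Set.ncard_le_ncard Set.inter_subset_left
  have h₅ : (powCommutator (⊤ : Subgroup G) p).index = {g : G | g ^ p = 1}.ncard := h
  have hCeq := ih _ (card_lt_card_of_ne_top hC) (hG.to_subgroup C)
    (by rw [index_powCommutator_top, ncard_inter_subgroup] at *; omega) rfl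
  rw [index_powCommutator_top, ncard_inter_subgroup] at h₃
  have hΩ := Set.eq_of_subset_of_ncard_le (s := {g : G | g ^ p = 1} ∩ C) Set.inter_subset_left
    (by omega)
  have hSC : S ≤ powCommutator C p := le_of_relIndex_le hCS (hSF.trans hFC) (by omega)
  have hP : powCommutator C p = powSubgroup C p := by
    refine le_antisymm ?_ le_sup_left
    have := map_mono (f := C.subtype) hCeq
    rwa [map_powCommutator, map_powSubgroup, ← MonoidHom.range_eq_map, range_subtype] at this
  rw [hP] at hSC h₂ h₃
  exact powCommutator_top_le_of_relIndex_eq hp hp3 hG hFC (hFS.trans hSC)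
    (fun g hg ↦ (hΩ.ge hg).2) (by omega)

end Counting

/-- Let `p ≥ 5` and `G` a finite `p`-group with
`|G : G^p [G,G]| = |{g ∈ G : g^p = 1}|`. Then `G` is powerful: `[G,G] ≤ G^p`. -/
theorem powerful_of_frattini_index_eq {G : Type*} [Group G] [Finite G] {p : ℕ}
    (hp : p.Prime) (hp5 : 5 ≤ p) (hG : IsPGroup p G)
    (h : (powSubgroup (⊤ : Subgroup G) p ⊔ commutator G).index =
      Nat.card {g : G | g ^ p = 1}) :
    commutator G ≤ powSubgroup (⊤ : Subgroup G) p :=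
  le_sup_right.trans (powCommutator_top_le_powSubgroup hp (by omega) hG h)
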